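/- Let X be a random vector in ℝ^ℓ whose law is a Gaussian measure with mean vector μ and covariance matrix C, let m ≥ 1 be an integer, let U be uniformly distributed on the cube [0, 1/m)^ℓ and independent of X, and set W := [X]_m + U. Let G denote the Gaussian measure on ℝ^ℓ whose mean vector and covariance matrix equal those of W. Then the Kullback–Leibler divergence satisfies KL(law(W) ‖ G) ≤ ℓ·( (1/2)·log(2π·(1 + 1/12)) + 75/2 + 24/π ). -/

import Mathlib

open MeasureTheory ProbabilityTheory Filter Set
open scoped ENNReal NNReal

/-- Uniform quantization with step size `1/m`: `[x]_m = ⌊m x⌋ / m`. -/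
noncomputable def quant (m : ℕ) (x : ℝ) : ℝ := ⌊(m : ℝ) * x⌋ / m

attribute [local instance] Classical.propDecidable

/-- Kullback–Leibler divergence between measures, valued in `[0,∞]`
(`∞` unless `π ≪ ρ` and the log-likelihood ratio is `π`-integrable). -/
noncomputable def KL {α : Type*} [MeasurableSpace α] (π ρ : Measure α) : ℝ≥0∞ :=
  if π ≪ ρ ∧ Integrable (fun x => Real.log ((π.rnDeriv ρ x).toReal)) π then
    ENNReal.ofReal (∫ x, Real.log ((π.rnDeriv ρ x).toReal) ∂π)
  else ⊤

/-- Mean of the `i`-th coordinate of a measure on `ι → ℝ`. -/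
noncomputable def meanVec {ι : Type*} (ν : Measure (ι → ℝ)) (i : ι) : ℝ := ∫ x, x i ∂ν

/-- `(i,j)`-th entry of the covariance matrix of a measure on `ι → ℝ`. -/
noncomputable def covVec {ι : Type*} (ν : Measure (ι → ℝ)) (i j : ι) : ℝ :=
  ∫ x, (x i - meanVec ν i) * (x j - meanVec ν j) ∂ν

/-- A probability measure on `ι → ℝ` is Gaussian iff every linear functional pushes it
forward to a one-dimensional Gaussian law. -/
def IsGaussianVec {ι : Type*} [Fintype ι] (ν : Measure (ι → ℝ)) : Prop :=
  IsProbabilityMeasure ν ∧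
    ∀ a : ι → ℝ, ∃ (c : ℝ) (v : ℝ≥0),
      ν.map (fun x => ∑ i, a i * x i) = gaussianReal c v

lemma aux_pi_mono {n : ℕ} (μ ν : Fin n → Measure ℝ) (h : ∀ i, μ i ≤ ν i) :
    Measure.pi μ ≤ Measure.pi ν := by
  refine Measure.le_iff.2 fun s hs => ?_
  rw [Measure.pi, Measure.pi, toMeasure_apply _ _ hs, toMeasure_apply _ _ hs]
  suffices (OuterMeasure.pi fun i => (μ i).toOuterMeasure) ≤
      OuterMeasure.pi fun i => (ν i).toOuterMeasure by exact this _
  rw [OuterMeasure.le_pi]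
  intro t _
  refine (OuterMeasure.pi_pi_le _ t).trans ?_
  exact Finset.prod_le_prod' fun i _ => h i (t i)

lemma aux_KL {α : Type*} [MeasurableSpace α] (P G : Measure α) [IsProbabilityMeasure P]
    [IsProbabilityMeasure G] (C : ℝ) (q : α → ℝ) (hq : Measurable q)
    (hle : P ≤ ENNReal.ofReal (Real.exp C) • G.withDensity (fun x => ENNReal.ofReal (Real.exp (q x))))
    (h1 : ∫⁻ x, ENNReal.ofReal (Real.exp (q x)) ∂G = 1)
    (hqP : Integrable q P) (hqG : Integrable q G) (heq : ∫ x, q x ∂P = ∫ x, q x ∂G) :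
    KL P G ≤ ENNReal.ofReal C := by
  have hac : P ≪ G := by
    refine (Measure.absolutelyContinuous_of_le hle).trans ?_
    exact (Measure.smul_absolutelyContinuous).trans (withDensity_absolutelyContinuous _ _)
  set f := P.rnDeriv G with hf
  have hfle : f ≤ᵐ[G] fun x => ENNReal.ofReal (Real.exp (C + q x)) := by
    refine ae_le_of_forall_setLIntegral_le_of_sigmaFinite (Measure.measurable_rnDeriv _ _) ?_
    intro s hs _
    rw [Measure.setLIntegral_rnDeriv hac]
    refine (hle s).trans ?_
    rw [Measure.smul_apply, withDensity_apply _ hs, smul_eq_mul,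
      ← lintegral_const_mul _ (by fun_prop)]
    refine lintegral_mono fun x => ?_
    rw [← ENNReal.ofReal_mul (Real.exp_nonneg _), ← Real.exp_add]
  have hlog : ∀ᵐ x ∂G, (f x).toReal * Real.log (f x).toReal ≤ (f x).toReal * (C + q x) := by
    filter_upwards [hfle] with x hx
    rcases eq_or_lt_of_le (ENNReal.toReal_nonneg (a := f x)) with h0 | h0
    · simp [← h0]
    · refine mul_le_mul_of_nonneg_left ?_ h0.le
      rw [← Real.log_exp (C + q x)]
      refine Real.log_le_log h0 ?_
      have := ENNReal.toReal_mono (by simp) hx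
      rwa [ENNReal.toReal_ofReal (Real.exp_nonneg _)] at this
  have hI1 : Integrable (fun x => (f x).toReal * (C + q x)) G :=
    (integrable_rnDeriv_smul_iff hac).2 ((integrable_const C).add hqP)
  have hI2 : Integrable (fun x => (f x).toReal * Real.log (f x).toReal) G := by
    refine Integrable.mono' ((integrable_const (1:ℝ)).add hI1.norm) ?_ ?_
    · have : Measurable f := Measure.measurable_rnDeriv _ _
      exact Measurable.aestronglyMeasurable (by fun_prop)
    · filter_upwards [hlog] with x hx
      have h0 : -1 ≤ (f x).toReal * Real.log (f x).toReal := by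
        rcases eq_or_lt_of_le (ENNReal.toReal_nonneg (a := f x)) with h0 | h0
        · simp [← h0]
        · have := mul_le_mul_of_nonneg_left (Real.one_sub_inv_le_log_of_pos h0) h0.le
          rw [mul_sub, mul_inv_cancel₀ h0.ne'] at this
          linarith
      have h3 := le_abs_self ((f x).toReal * (C + q x))
      have h4 := abs_nonneg ((f x).toReal * (C + q x))
      simp only [Pi.add_apply, Real.norm_eq_abs]
      rw [abs_le]
      constructor <;> linarith
  have hI3 : Integrable (fun x => Real.log ((P.rnDeriv G x).toReal)) P :=
    (integrable_rnDeriv_mul_log_iff hac).1 hI2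
  rw [KL, if_pos ⟨hac, hI3⟩]
  refine ENNReal.ofReal_le_ofReal ?_
  have e1 : ∫ x, Real.log ((P.rnDeriv G x).toReal) ∂P
      = ∫ x, (f x).toReal * Real.log (f x).toReal ∂G := (integral_rnDeriv_mul_log hac).symm
  have e2 : ∫ x, (f x).toReal * (C + q x) ∂G = ∫ x, (C + q x) ∂P :=
    integral_rnDeriv_smul hac
  have e3 : ∫ x, (C + q x) ∂P = C + ∫ x, q x ∂G := by
    rw [integral_add (integrable_const _) hqP, heq]; simp
  have hexp : Integrable (fun x => Real.exp (q x)) G := by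
    refine ⟨Measurable.aestronglyMeasurable (by fun_prop), ?_⟩
    rw [hasFiniteIntegral_iff_ofReal (by filter_upwards with x using Real.exp_nonneg _), h1]
    simp
  have e4 : ∫ x, Real.exp (q x) ∂G = 1 := by
    rw [integral_eq_lintegral_of_nonneg_ae (by filter_upwards with x using Real.exp_nonneg _)
      hexp.1, h1]; simp
  have e5 : ∫ x, q x ∂G ≤ ∫ x, (Real.exp (q x) - 1) ∂G := by
    refine integral_mono hqG (hexp.sub (integrable_const _)) fun x => ?_
    have := Real.add_one_le_exp (q x)
    simp only; linarith
  rw [integral_sub hexp (integrable_const _), e4] at e5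
  simp at e5
  rw [e1]
  refine (integral_mono_ae hI2 hI1 hlog).trans ?_
  rw [e2, e3]; linarith

lemma aux_std_density (n : ℕ) :
    Measure.pi (fun _ : Fin n => gaussianReal 0 1) =
      (volume : Measure (Fin n → ℝ)).withDensity (fun x => ENNReal.ofReal
        (∏ i, gaussianPDFReal 0 1 (x i))) := by
  refine Measure.pi_eq fun s hs => ?_
  have hint : Integrable (fun x : Fin n → ℝ => ∏ i, gaussianPDFReal 0 1 (x i)) volume :=
    Integrable.fintype_prod (f := fun _ => gaussianPDFReal 0 1)
      (fun _ => integrable_gaussianPDFReal 0 1)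
  rw [withDensity_apply _ (MeasurableSet.univ_pi hs), ← ofReal_integral_eq_lintegral_ofReal
    hint.restrict (by filter_upwards with x using
      Finset.prod_nonneg fun i _ => gaussianPDFReal_nonneg _ _ _), volume_pi,
    Measure.restrict_pi_pi, integral_fintype_prod_eq_prod (f := fun _ => gaussianPDFReal 0 1),
    ENNReal.ofReal_prod_of_nonneg
      (fun i _ => integral_nonneg fun x => gaussianPDFReal_nonneg _ _ _)]
  refine Finset.prod_congr rfl fun i _ => ?_
  rw [gaussianReal_apply_eq_integral _ (by simp)]

lemma aux_isGaussian {n : ℕ} (ν : Measure (Fin n → ℝ)) (h : IsGaussianVec ν) : IsGaussian ν := by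
  refine isGaussian_of_map_eq_gaussianReal fun L => ?_
  obtain ⟨c, v, hcv⟩ := h.2 (fun i => L (Pi.single i 1))
  refine ⟨c, v, ?_⟩
  rw [← hcv]
  congr 1
  ext x
  conv_lhs => rw [← Finset.univ_sum_single x, map_sum]
  refine Finset.sum_congr rfl fun i _ => ?_
  have : (Pi.single i (x i) : Fin n → ℝ) = (x i) • Pi.single i (1:ℝ) := by
    ext j; by_cases hj : j = i
    · subst hj; simp
    · simp [hj]
  rw [this, map_smul, smul_eq_mul, mul_comm]

lemma aux_memLp {n : ℕ} (ν : Measure (Fin n → ℝ)) [IsGaussian ν] (i : Fin n) :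
    MemLp (fun x : Fin n → ℝ => x i) 2 ν :=
  IsGaussian.memLp_dual ν (ContinuousLinearMap.proj i) 2 (by simp)

lemma aux_mean_lin {n : ℕ} (ν : Measure (Fin n → ℝ)) [IsProbabilityMeasure ν]
    (h2 : ∀ i, MemLp (fun x : Fin n → ℝ => x i) 2 ν) (a : Fin n → ℝ) :
    ∫ x, ∑ i, a i * x i ∂ν = ∑ i, a i * meanVec ν i := by
  rw [integral_finsetSum]
  · simp [integral_const_mul, meanVec]
  · intro i _
    exact ((h2 i).integrable (by norm_num)).const_mul _

lemma aux_var_lin {n : ℕ} (ν : Measure (Fin n → ℝ)) [IsProbabilityMeasure ν]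
    (h2 : ∀ i, MemLp (fun x : Fin n → ℝ => x i) 2 ν) (a : Fin n → ℝ) :
    Var[fun x => ∑ i, a i * x i; ν] = ∑ i, ∑ j, a i * a j * covVec ν i j := by
  rw [variance_fun_sum fun i => (h2 i).const_mul (a i)]
  refine Finset.sum_congr rfl fun i _ => Finset.sum_congr rfl fun j _ => ?_
  rw [covariance_const_mul_left, covariance_const_mul_right]
  rw [← mul_assoc]; rfl

lemma aux_gauss_ext {n : ℕ} (ν ν' : Measure (Fin n → ℝ)) [IsGaussian ν] [IsGaussian ν']
    (hm : ∀ i, meanVec ν i = meanVec ν' i) (hc : ∀ i j, covVec ν i j = covVec ν' i j) :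
    ν = ν' := by
  refine Measure.ext_of_charFunDual ?_
  ext L
  rw [IsGaussian.charFunDual_eq, IsGaussian.charFunDual_eq]
  have hL : (L : (Fin n → ℝ) → ℝ) = fun x => ∑ i, L (Pi.single i 1) * x i := by
    ext x
    conv_lhs => rw [← Finset.univ_sum_single x, map_sum]
    refine Finset.sum_congr rfl fun i _ => ?_
    have : (Pi.single i (x i) : Fin n → ℝ) = (x i) • Pi.single i (1:ℝ) := by
      ext j; by_cases hj : j = i
      · subst hj; simp
      · simp [hj]
    rw [this, map_smul, smul_eq_mul, mul_comm]
  have e1 : ∫ x, L x ∂ν = ∫ x, L x ∂ν' := by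
    rw [hL, aux_mean_lin ν (aux_memLp ν), aux_mean_lin ν' (aux_memLp ν')]
    simp [hm]
  have e2 : Var[L; ν] = Var[L; ν'] := by
    rw [hL, aux_var_lin ν (aux_memLp ν), aux_var_lin ν' (aux_memLp ν')]
    simp [hc]
  rw [e2]
  simp only [integral_complex_ofReal]
  rw [e1]

lemma aux_pi_gauss {n : ℕ} (v : ℝ≥0) :
    IsGaussian (Measure.pi (fun _ : Fin n => gaussianReal 0 v)) := by
  have h := (iIndepFun_pi (μ := fun _ : Fin n => gaussianReal 0 v) (X := fun _ => id)
    (fun i => aemeasurable_id)).hasGaussianLaw (fun i => by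
      constructor
      rw [show (fun ω : Fin n → ℝ => id (ω i)) = Function.eval i from rfl,
        (measurePreserving_eval (fun _ : Fin n => gaussianReal 0 v) i).map_eq]
      infer_instance)
  have := h.isGaussian_map
  simpa using this

lemma aux_pi_mean {n : ℕ} (v : ℝ≥0) (i : Fin n) :
    meanVec (Measure.pi (fun _ : Fin n => gaussianReal 0 v)) i = 0 := by
  have := integral_map (μ := Measure.pi (fun _ : Fin n => gaussianReal 0 v))
    (φ := Function.eval i) (f := fun y : ℝ => y) (measurable_pi_apply i).aemeasurable (by fun_prop)
  rw [(measurePreserving_eval (fun _ : Fin n => gaussianReal 0 v) i).map_eq] at this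
  simp only [integral_id_gaussianReal] at this
  exact this.symm

lemma aux_pi_cov {n : ℕ} (i j : Fin n) :
    covVec (Measure.pi (fun _ : Fin n => gaussianReal 0 1)) i j = if i = j then 1 else 0 := by
  have hG := aux_pi_gauss (n := n) 1
  have hm := aux_memLp (Measure.pi (fun _ : Fin n => gaussianReal 0 1))
  change cov[fun x : Fin n → ℝ => x i, fun x => x j; Measure.pi (fun _ : Fin n => gaussianReal 0 1)] = _
  split_ifs with h
  · subst h
    rw [covariance_self (hm i).aemeasurable]
    have := variance_map (μ := Measure.pi (fun _ : Fin n => gaussianReal 0 1))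
      (Y := Function.eval i) (X := fun y : ℝ => y) (by fun_prop) (measurable_pi_apply i).aemeasurable
    rw [(measurePreserving_eval (fun _ : Fin n => gaussianReal 0 1) i).map_eq] at this
    simpa [Function.comp_def] using this.symm
  · refine IndepFun.covariance_eq_zero ?_ (hm i) (hm j)
    exact (iIndepFun_pi (μ := fun _ : Fin n => gaussianReal 0 1) (X := fun _ => id)
      (fun i => aemeasurable_id)).indepFun h

lemma aux_map_density {n : ℕ} (A : Matrix (Fin n) (Fin n) ℝ) (hA : A.det ≠ 0) (b : Fin n → ℝ) :
    ∃ (c : ℝ), (Measure.pi (fun _ : Fin n => gaussianReal 0 1)).map (fun x => b + A.mulVec x) =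
      (volume : Measure (Fin n → ℝ)).withDensity (fun x => ENNReal.ofReal (Real.exp
        (c + ∑ k, -(∑ j, A⁻¹ k j * (x j - b j)) ^ 2 / 2))) := by
  have hvol : (volume : Measure (Fin n → ℝ)).map (fun x => b + A.mulVec x) =
      ENNReal.ofReal |(A.det)⁻¹| • volume := by
    have h1 := Real.map_matrix_volume_pi_eq_smul_volume_pi hA
    have h2 : (fun x => b + A.mulVec x) = (fun x => b + x) ∘ (Matrix.toLin' A) := by
      ext x; simp [Matrix.toLin'_apply]
    rw [h2, ← Measure.map_map (by fun_prop) (by exact (Matrix.toLin' A).continuous_of_finiteDimensional.measurable), h1,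
      Measure.map_smul, map_add_left_eq_self]
  have hTm : Measurable (fun x : Fin n → ℝ => b + A.mulVec x) := by
    have : Continuous (fun x : Fin n → ℝ => A.mulVec x) := by fun_prop
    fun_prop
  have hd : 0 < |(A.det)⁻¹| := abs_pos.2 (inv_ne_zero hA)
  refine ⟨Real.log |(A.det)⁻¹| + ∑ k : Fin n, Real.log (√(2 * Real.pi * (1:ℝ≥0)))⁻¹, ?_⟩
  ext s hs
  rw [Measure.map_apply hTm hs, aux_std_density, withDensity_apply _ (hTm hs), withDensity_apply _ hs]
  have e1 : ∀ x : Fin n → ℝ, ENNReal.ofReal (∏ i, gaussianPDFReal 0 1 (x i)) =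
      (fun y : Fin n → ℝ => ENNReal.ofReal (∏ i, gaussianPDFReal 0 1 (A⁻¹.mulVec (y - b) i)))
        (b + A.mulVec x) := by
    intro x
    simp [Matrix.mulVec_mulVec, Matrix.nonsing_inv_mul _ (isUnit_iff_ne_zero.2 hA)]
  have hgm : Measurable (fun y : Fin n → ℝ =>
      ENNReal.ofReal (∏ i, gaussianPDFReal 0 1 (A⁻¹.mulVec (y - b) i))) := by
    have : Continuous (fun x : Fin n → ℝ => A⁻¹.mulVec (x - b)) := by fun_prop
    have h3 : ∀ i, Measurable (fun x : Fin n → ℝ => A⁻¹.mulVec (x - b) i) := fun i =>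
      (measurable_pi_apply i).comp this.measurable
    have h4 := measurable_gaussianPDFReal 0 1
    refine ENNReal.measurable_ofReal.comp (Finset.measurable_prod _ fun i _ => h4.comp (h3 i))
  rw [lintegral_congr e1, ← setLIntegral_map hs hgm hTm, hvol, Measure.restrict_smul,
    lintegral_smul_measure, smul_eq_mul, ← lintegral_const_mul _ hgm]
  refine lintegral_congr fun x => ?_
  rw [← ENNReal.ofReal_mul hd.le]
  congr 1
  rw [Real.exp_add, Real.exp_add, Real.exp_log hd, mul_assoc, ← Real.exp_add,
    ← Finset.sum_add_distrib, Real.exp_sum]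
  congr 1
  refine Finset.prod_congr rfl fun k _ => ?_
  rw [Real.exp_add, Real.exp_log (by positivity), gaussianPDFReal]
  simp [Matrix.mulVec, dotProduct]

open scoped MatrixOrder Matrix.Norms.L2Operator in
lemma aux_factor {n : ℕ} (S : Matrix (Fin n) (Fin n) ℝ) (hS : S.PosDef) :
    ∃ A : Matrix (Fin n) (Fin n) ℝ, A.det ≠ 0 ∧ S = A * A.transpose := by
  obtain ⟨y, hy⟩ := CStarAlgebra.nonneg_iff_eq_star_mul_self.mp hS.posSemidef.nonneg
  rw [Matrix.star_eq_conjTranspose, Matrix.conjTranspose_eq_transpose_of_trivial] at hy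
  refine ⟨y.transpose, ?_, by rw [Matrix.transpose_transpose]; exact hy⟩
  have := hS.det_pos
  rw [hy, Matrix.det_mul] at this
  exact left_ne_zero_of_mul this.ne'

lemma aux_density {n : ℕ} (ν : Measure (Fin n → ℝ)) [IsGaussian ν]
    (hnd : ∀ a : Fin n → ℝ, a ≠ 0 → Var[fun x => ∑ i, a i * x i; ν] ≠ 0) :
    ∃ (c : ℝ) (B : Matrix (Fin n) (Fin n) ℝ) (b : Fin n → ℝ),
      ν = (volume : Measure (Fin n → ℝ)).withDensity (fun x => ENNReal.ofReal (Real.exp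
        (c + ∑ k, -(∑ j, B k j * (x j - b j)) ^ 2 / 2))) := by
  have hS : (Matrix.of fun i j => covVec ν i j).PosDef := by
    refine Matrix.PosDef.of_dotProduct_mulVec_pos ?_ ?_
    · ext i j
      simp [covVec, mul_comm]
    · intro a ha
      have h1 := aux_var_lin ν (aux_memLp ν) a
      have h2 : star a ⬝ᵥ (Matrix.of fun i j => covVec ν i j).mulVec a =
          Var[fun x => ∑ i, a i * x i; ν] := by
        rw [h1]
        simp only [dotProduct, Matrix.mulVec, Finset.mul_sum, Matrix.of_apply]
        refine Finset.sum_congr rfl fun i _ => Finset.sum_congr rfl fun j _ => ?_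
        simp; ring
      rw [h2]
      exact lt_of_le_of_ne (variance_nonneg _ _) (hnd a ha).symm
  obtain ⟨A, hA, hSA⟩ := aux_factor _ hS
  obtain ⟨c, hc⟩ := aux_map_density A hA (meanVec ν)
  refine ⟨c, A⁻¹, meanVec ν, ?_⟩
  rw [← hc]
  have hG := aux_pi_gauss (n := n) 1
  set γ := Measure.pi (fun _ : Fin n => gaussianReal 0 1) with hγ
  have hm := aux_memLp γ
  have hTm : Measurable (fun x : Fin n → ℝ => meanVec ν + A.mulVec x) := by
    have : Continuous (fun x : Fin n → ℝ => A.mulVec x) := by fun_prop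
    fun_prop
  have hG2 : IsGaussian (γ.map (fun x => meanVec ν + A.mulVec x)) := by
    have h2 : (fun x => meanVec ν + A.mulVec x) = (fun x => meanVec ν + x) ∘
        (LinearMap.toContinuousLinearMap (Matrix.toLin' A)) := by
      ext x; simp [Matrix.toLin'_apply]
    rw [h2, ← Measure.map_map (by fun_prop) (by fun_prop)]
    infer_instance
  have hmean : ∀ i, meanVec (γ.map (fun x => meanVec ν + A.mulVec x)) i = meanVec ν i := by
    intro i
    rw [meanVec, integral_map hTm.aemeasurable (measurable_pi_apply i).aestronglyMeasurable]
    simp only [Pi.add_apply, Matrix.mulVec, dotProduct]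
    rw [integral_add (integrable_const _)
      (integrable_finsetSum _ fun k _ => ((hm k).integrable (by norm_num)).const_mul _),
      aux_mean_lin γ hm]
    simp [hγ, aux_pi_mean]
  refine aux_gauss_ext _ _ (fun i => (hmean i).symm) ?_
  intro i j
  have h3 : covVec (γ.map (fun x => meanVec ν + A.mulVec x)) i j =
      cov[fun x => ∑ k, A i k * x k, fun x => ∑ k, A j k * x k; γ] := by
    rw [covVec, hmean, hmean, integral_map hTm.aemeasurable (by fun_prop), covariance,
      aux_mean_lin γ hm, aux_mean_lin γ hm]
    simp [hγ, aux_pi_mean, Matrix.mulVec, dotProduct]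
  rw [h3, covariance_fun_sum_fun_sum (fun k => (hm k).const_mul _) (fun k => (hm k).const_mul _)]
  have h4 : covVec ν i j = (A * A.transpose) i j := by rw [← hSA]; rfl
  rw [h4, Matrix.mul_apply]
  refine Finset.sum_congr rfl fun k _ => ?_
  have h5 : ∀ l, cov[fun x : Fin n → ℝ => A i k * x k, fun x => A j l * x l; γ] =
      if k = l then A i k * A j l else 0 := by
    intro l
    rw [covariance_const_mul_left, covariance_const_mul_right]
    change A i k * (A j l * covVec γ k l) = _
    rw [hγ, aux_pi_cov]
    split_ifs <;> simp
  simp [h5]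

lemma aux_sq_good {n : ℕ} (P Q : Measure (Fin n → ℝ)) [IsProbabilityMeasure P]
    [IsProbabilityMeasure Q] (hP : ∀ i, MemLp (fun x : Fin n → ℝ => x i) 2 P)
    (hQ : ∀ i, MemLp (fun x : Fin n → ℝ => x i) 2 Q)
    (hm : ∀ i, meanVec P i = meanVec Q i) (hc : ∀ i j, covVec P i j = covVec Q i j)
    (c : ℝ) (B : Matrix (Fin n) (Fin n) ℝ) (b : Fin n → ℝ) :
    Integrable (fun x => c + ∑ k, -(∑ j, B k j * (x j - b j)) ^ 2 / 2) P ∧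
    Integrable (fun x => c + ∑ k, -(∑ j, B k j * (x j - b j)) ^ 2 / 2) Q ∧
    ∫ x, (c + ∑ k, -(∑ j, B k j * (x j - b j)) ^ 2 / 2) ∂P =
    ∫ x, (c + ∑ k, -(∑ j, B k j * (x j - b j)) ^ 2 / 2) ∂Q := by
  have key : ∀ (ρ : Measure (Fin n → ℝ)) [IsProbabilityMeasure ρ]
      (hR : ∀ i, MemLp (fun x : Fin n → ℝ => x i) 2 ρ),
      Integrable (fun x => c + ∑ k, -(∑ j, B k j * (x j - b j)) ^ 2 / 2) ρ ∧
      ∫ x, (c + ∑ k, -(∑ j, B k j * (x j - b j)) ^ 2 / 2) ∂ρ =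
        c + ∑ k, -((∑ i, ∑ j, B k i * B k j * covVec ρ i j) +
          (∑ j, B k j * (meanVec ρ j - b j)) ^ 2) / 2 := by
    intro ρ _ hR
    have hL : ∀ k, MemLp (fun x : Fin n → ℝ => ∑ j, B k j * (x j - b j)) 2 ρ := fun k =>
      memLp_finsetSum _ fun j _ => ((hR j).sub (memLp_const _)).const_mul _
    have hI : ∀ k, Integrable (fun x : Fin n → ℝ => -(∑ j, B k j * (x j - b j)) ^ 2 / 2) ρ :=
      fun k => (hL k).integrable_sq.neg.div_const _
    have hI2 := integrable_finsetSum Finset.univ fun k _ => hI k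
    refine ⟨(integrable_const c).add hI2, ?_⟩
    rw [integral_add (integrable_const c) hI2, integral_finsetSum _ fun k _ => hI k]
    simp only [integral_const, probReal_univ, one_smul]
    congr 1
    refine Finset.sum_congr rfl fun k _ => ?_
    rw [integral_div, integral_neg]
    congr 2
    have h1 := variance_eq_sub (hL k)
    have h2 : Var[fun x : Fin n → ℝ => ∑ j, B k j * (x j - b j); ρ] =
        ∑ i, ∑ j, B k i * B k j * covVec ρ i j := by
      rw [← aux_var_lin ρ hR]
      have : (fun x : Fin n → ℝ => ∑ j, B k j * (x j - b j)) =
          fun x => (∑ j, B k j * x j) - ∑ j, B k j * b j := by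
        ext x; simp [mul_sub]
      rw [this, variance_sub_const]
      exact (memLp_finsetSum _ fun j _ => (hR j).const_mul _).aestronglyMeasurable
    have h3 : ∫ x : Fin n → ℝ, ∑ j, B k j * (x j - b j) ∂ρ =
        ∑ j, B k j * (meanVec ρ j - b j) := by
      have hI3 : ∀ j, Integrable (fun x : Fin n → ℝ => B k j * (x j - b j)) ρ := fun j =>
        (((hR j).integrable (by norm_num)).sub (integrable_const _)).const_mul _
      rw [integral_finsetSum _ fun j _ => hI3 j]
      refine Finset.sum_congr rfl fun j _ => ?_
      rw [integral_const_mul, integral_sub ((hR j).integrable (by norm_num)) (integrable_const _)]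
      simp [meanVec]
    rw [← h2, ← h3, h1]
    simp
  obtain ⟨k1, k2⟩ := key P hP
  obtain ⟨k3, k4⟩ := key Q hQ
  refine ⟨k1, k3, ?_⟩
  rw [k2, k4]
  simp [hm, hc]

lemma aux_1d (m : ℕ) (hm : 1 ≤ m) (t : ℝ) (ht1 : -(1 / (m:ℝ)) ≤ t) (ht2 : t ≤ 0) :
    ((m : ℝ≥0∞) • (volume.restrict (Set.Ico (0 : ℝ) (1 / m)))).map (fun u => t + u) ≤
      ENNReal.ofReal (√(2 * Real.pi) * Real.exp (1 / 2)) •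
        gaussianReal 0 ((1 / (m : ℝ≥0)) ^ 2) := by
  have hm0 : (0:ℝ) < m := by exact_mod_cast hm
  have hv : (1 / (m : ℝ≥0)) ^ 2 ≠ 0 := by
    have : (m : ℝ≥0) ≠ 0 := by exact_mod_cast (by omega : m ≠ 0)
    positivity
  have hmt : Measurable (fun u : ℝ => t + u) := by fun_prop
  refine Measure.le_iff.2 fun s hs => ?_
  rw [Measure.map_apply hmt hs, Measure.smul_apply, Measure.smul_apply,
    Measure.restrict_apply (hmt hs), gaussianReal_apply _ hv, smul_eq_mul, smul_eq_mul]
  have h1 : (fun u : ℝ => t + u) ⁻¹' s ∩ Ico 0 (1 / (m:ℝ)) ⊆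
      (fun u : ℝ => t + u) ⁻¹' (s ∩ Icc (-(1 / (m:ℝ))) (1 / m)) := by
    rintro u ⟨hu, hu1, hu2⟩
    refine ⟨hu, ?_, ?_⟩ <;> simp only <;> linarith
  calc (m : ℝ≥0∞) * volume ((fun u : ℝ => t + u) ⁻¹' s ∩ Ico 0 (1 / (m:ℝ)))
      ≤ (m : ℝ≥0∞) * volume (s ∩ Icc (-(1 / (m:ℝ))) (1 / m)) := by
        refine mul_le_mul' le_rfl ?_
        refine (measure_mono (μ := (volume : Measure ℝ)) h1).trans ?_
        rw [measure_preimage_add]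
    _ = ∫⁻ x in s ∩ Icc (-(1 / (m:ℝ))) (1 / m), (m : ℝ≥0∞) := by simp
    _ ≤ ∫⁻ x in s ∩ Icc (-(1 / (m:ℝ))) (1 / m),
          ENNReal.ofReal (√(2 * Real.pi) * Real.exp (1 / 2)) *
            gaussianPDF 0 ((1 / (m : ℝ≥0)) ^ 2) x := by
        refine setLIntegral_mono' (hs.inter measurableSet_Icc) fun x hx => ?_
        rw [gaussianPDF, ← ENNReal.ofReal_mul (by positivity), ← ENNReal.ofReal_natCast]
        refine ENNReal.ofReal_le_ofReal ?_
        rw [gaussianPDFReal]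
        have hx2 : x ^ 2 ≤ (1 / (m:ℝ)) ^ 2 := sq_le_sq' hx.2.1 hx.2.2
        have e1 : √(2 * Real.pi * ((1 / (m : ℝ≥0)) ^ 2 : ℝ≥0)) = √(2 * Real.pi) * (1 / m) := by
          push_cast
          rw [Real.sqrt_mul (by positivity), Real.sqrt_sq (by positivity)]
        rw [e1]
        have e2 : Real.exp (-(1/2)) ≤
            Real.exp (-(x - 0) ^ 2 / (2 * ((1 / (m : ℝ≥0)) ^ 2 : ℝ≥0))) := by
          refine Real.exp_le_exp.2 ?_
          push_cast
          rw [le_div_iff₀ (by positivity), sub_zero]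
          linarith
        have hsp : 0 < √(2 * Real.pi) := by positivity
        calc (m:ℝ) = √(2 * Real.pi) * Real.exp (1 / 2) *
              ((√(2 * Real.pi) * (1 / m))⁻¹ * Real.exp (-(1/2))) := by
              rw [Real.exp_neg]
              have := Real.exp_pos (1/2)
              field_simp
          _ ≤ _ := by gcongr
    _ ≤ ∫⁻ x in s, ENNReal.ofReal (√(2 * Real.pi) * Real.exp (1 / 2)) *
            gaussianPDF 0 ((1 / (m : ℝ≥0)) ^ 2) x :=
        lintegral_mono_set inter_subset_left
    _ = _ := by rw [lintegral_const_mul _ (measurable_gaussianPDF _ _)]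

lemma aux_quant (m : ℕ) (hm : 1 ≤ m) (x : ℝ) :
    -(1 / (m:ℝ)) ≤ quant m x - x ∧ quant m x - x ≤ 0 := by
  have hm0 : (0:ℝ) < m := by exact_mod_cast hm
  have h1 := Int.floor_le ((m:ℝ) * x)
  have h2 := Int.lt_floor_add_one ((m:ℝ) * x)
  have e : quant m x - x = (⌊(m:ℝ) * x⌋ - m * x) / m := by
    rw [quant]; field_simp
  rw [e]
  constructor
  · rw [le_div_iff₀ hm0]
    have : -(1 / (m:ℝ)) * m = -1 := by field_simp
    linarith
  · exact div_nonpos_of_nonpos_of_nonneg (by linarith) hm0.le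

lemma aux_quant_meas (m : ℕ) : Measurable (quant m) := by
  unfold quant
  have : Measurable (fun x : ℝ => (⌊(m:ℝ) * x⌋ : ℝ)) := by
    have h : Measurable (fun x : ℝ => ⌊(m:ℝ) * x⌋) := by fun_prop
    exact (measurable_from_top (f := fun z : ℤ => (z : ℝ))).comp h
  exact this.div_const _

lemma aux_pi_dom {n : ℕ} (m : ℕ) (hm : 1 ≤ m) (t : Fin n → ℝ)
    (ht : ∀ i, -(1 / (m:ℝ)) ≤ t i ∧ t i ≤ 0) :
    (Measure.pi (fun _ : Fin n =>
      (m : ℝ≥0∞) • (volume.restrict (Set.Ico (0 : ℝ) (1 / m))))).map (fun u => t + u) ≤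
      ENNReal.ofReal (√(2 * Real.pi) * Real.exp (1 / 2)) ^ n •
        Measure.pi (fun _ : Fin n => gaussianReal 0 ((1 / (m : ℝ≥0)) ^ 2)) := by
  have hfin : IsFiniteMeasure ((m : ℝ≥0∞) • (volume.restrict (Set.Ico (0 : ℝ) (1 / m)))) :=
    Measure.smul_finite _ (by simp)
  have e1 := Measure.pi_map_pi (μ := fun _ : Fin n =>
      (m : ℝ≥0∞) • (volume.restrict (Set.Ico (0 : ℝ) (1 / m)))) (f := fun i u => t i + u)
      (fun i => by fun_prop)
  have e2 : (fun u : Fin n → ℝ => t + u) = fun u i => t i + u i := rfl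
  rw [e2, e1]
  refine (aux_pi_mono _ (fun _ : Fin n => ENNReal.ofReal (√(2 * Real.pi) * Real.exp (1 / 2)) •
    gaussianReal 0 ((1 / (m : ℝ≥0)) ^ 2)) fun i => aux_1d m hm (t i) (ht i).1 (ht i).2).trans ?_
  have hfin2 : IsFiniteMeasure (ENNReal.ofReal (√(2 * Real.pi) * Real.exp (1 / 2)) •
    gaussianReal 0 ((1 / (m : ℝ≥0)) ^ 2)) := Measure.smul_finite _ ENNReal.ofReal_ne_top
  refine le_of_eq (Measure.pi_eq fun s hs => ?_)
  rw [Measure.smul_apply, Measure.pi_pi]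
  simp [Finset.prod_mul_distrib]

lemma aux_dom {n : ℕ} (m : ℕ) (hm : 1 ≤ m) (P : Measure (Fin n → ℝ)) [IsProbabilityMeasure P]
    (V : Measure (Fin n → ℝ)) (hV : V = Measure.pi (fun _ : Fin n =>
      (m : ℝ≥0∞) • (volume.restrict (Set.Ico (0 : ℝ) (1 / m))))) [IsProbabilityMeasure V] :
    (P.prod V).map (fun p i => quant m (p.1 i) + p.2 i) ≤
      ENNReal.ofReal (√(2 * Real.pi) * Real.exp (1 / 2)) ^ n •
        (P ∗ Measure.pi (fun _ : Fin n => gaussianReal 0 ((1 / (m : ℝ≥0)) ^ 2))) := by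
  have hq := aux_quant_meas m
  have hmeas : Measurable (fun (p : (Fin n → ℝ) × (Fin n → ℝ)) (i : Fin n) =>
      quant m (p.1 i) + p.2 i) := by
    refine measurable_pi_lambda _ fun i => ?_
    exact (hq.comp ((measurable_pi_apply i).comp measurable_fst)).add
      ((measurable_pi_apply i).comp measurable_snd)
  have hadd : Measurable (fun p : (Fin n → ℝ) × (Fin n → ℝ) => p.1 + p.2) := by fun_prop
  refine Measure.le_iff.2 fun s hs => ?_
  rw [Measure.map_apply hmeas hs, Measure.smul_apply, Measure.conv, Measure.map_apply hadd hs,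
    Measure.prod_apply (hmeas hs), Measure.prod_apply (hadd hs), smul_eq_mul,
    ← lintegral_const_mul _ (measurable_measure_prodMk_left (hadd hs))]
  refine lintegral_mono fun x => ?_
  have h := aux_pi_dom m hm (fun i => quant m (x i) - x i) (fun i => aux_quant m hm (x i))
  rw [← hV] at h
  have hs' : MeasurableSet (Prod.mk x ⁻¹' ((fun p : (Fin n → ℝ) × (Fin n → ℝ) => p.1 + p.2) ⁻¹' s)) :=
    measurable_prodMk_left (hadd hs)
  have h2 := h (Prod.mk x ⁻¹' ((fun p : (Fin n → ℝ) × (Fin n → ℝ) => p.1 + p.2) ⁻¹' s))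
  rw [Measure.map_apply (by fun_prop) hs', Measure.smul_apply, smul_eq_mul] at h2
  refine le_trans (le_of_eq ?_) h2
  congr 1
  ext u
  simp only [mem_preimage]
  have : (fun i => quant m (x i) + u i) = x + ((fun i => quant m (x i) - x i) + u) := by
    ext i; simp only [Pi.add_apply]; ring
  rw [this]

lemma aux_nondeg {n : ℕ} (ν : Measure (Fin n → ℝ)) [IsProbabilityMeasure ν]
    (h2 : ∀ i, MemLp (fun x : Fin n → ℝ => x i) 2 ν) (hac : ν ≪ volume)
    (a : Fin n → ℝ) (ha : a ≠ 0) : Var[fun x => ∑ i, a i * x i; ν] ≠ 0 := by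
  intro h0
  have hL : MemLp (fun x : Fin n → ℝ => ∑ i, a i * x i) 2 ν :=
    memLp_finsetSum _ fun j _ => (h2 j).const_mul _
  have h1 : evariance (fun x : Fin n → ℝ => ∑ i, a i * x i) ν = 0 := by
    rw [← hL.ofReal_variance_eq, h0]; simp
  rw [evariance_eq_zero_iff hL.aemeasurable] at h1
  set c := ∫ x, (∑ i, a i * x i) ∂ν with hc
  let φ : (Fin n → ℝ) →ₗ[ℝ] ℝ := ∑ i, a i • LinearMap.proj i
  have hφ : ∀ x, φ x = ∑ i, a i * x i := fun x => by simp [φ]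
  let S : AffineSubspace ℝ (Fin n → ℝ) := (AffineSubspace.mk' c ⊥).comap φ.toAffineMap
  have hmem : ∀ x, x ∈ S ↔ ∑ i, a i * x i = c := by
    intro x
    simp [S, AffineSubspace.mem_comap, AffineSubspace.mem_mk', hφ, sub_eq_zero]
  have hS : S ≠ ⊤ := by
    intro hT
    have h3 : ∀ x : Fin n → ℝ, ∑ i, a i * x i = c := fun x => (hmem x).1 (hT ▸ AffineSubspace.mem_top ℝ _ x)
    have h4 := h3 0
    have h5 := h3 a
    simp at h4
    rw [← h4] at h5
    apply ha
    ext i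
    have := (Finset.sum_eq_zero_iff_of_nonneg (fun i _ => mul_self_nonneg (a i))).1 h5 i (Finset.mem_univ i)
    simpa using this
  have h3 : ν S = 0 := hac (Measure.addHaar_affineSubspace volume S hS)
  have h4 : ∀ᵐ x ∂ν, x ∉ S := by
    rw [ae_iff]; simpa using h3
  have h5 : ∀ᵐ x ∂ν, False := by
    filter_upwards [h1, h4] with x hx hx'
    exact hx' ((hmem x).2 hx)
  simp at h5
  exact IsProbabilityMeasure.ne_zero ν h5

lemma aux_pi_ac (n : ℕ) (v : ℝ≥0) (hv : v ≠ 0) :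
    Measure.pi (fun _ : Fin n => gaussianReal 0 v) ≪ (volume : Measure (Fin n → ℝ)) := by
  have : Measure.pi (fun _ : Fin n => gaussianReal 0 v) =
      (volume : Measure (Fin n → ℝ)).withDensity (fun x => ENNReal.ofReal
        (∏ i, gaussianPDFReal 0 v (x i))) := by
    refine Measure.pi_eq fun s hs => ?_
    have hint : Integrable (fun x : Fin n → ℝ => ∏ i, gaussianPDFReal 0 v (x i)) volume :=
      Integrable.fintype_prod (f := fun _ => gaussianPDFReal 0 v)
        (fun _ => integrable_gaussianPDFReal 0 v)
    rw [withDensity_apply _ (MeasurableSet.univ_pi hs), ← ofReal_integral_eq_lintegral_ofReal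
      hint.restrict (by filter_upwards with x using
        Finset.prod_nonneg fun i _ => gaussianPDFReal_nonneg _ _ _), volume_pi,
      Measure.restrict_pi_pi, integral_fintype_prod_eq_prod (f := fun _ => gaussianPDFReal 0 v),
      ENNReal.ofReal_prod_of_nonneg
        (fun i _ => integral_nonneg fun x => gaussianPDFReal_nonneg _ _ _)]
    refine Finset.prod_congr rfl fun i _ => ?_
    rw [gaussianReal_apply_eq_integral _ hv]
  rw [this]
  exact withDensity_absolutelyContinuous _ _

lemma aux_ratio {α : Type*} [MeasurableSpace α] (ρ G H : Measure α) (q1 q2 : α → ℝ)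
    (hq1 : Measurable q1) (hq2 : Measurable q2)
    (hG : G = ρ.withDensity (fun x => ENNReal.ofReal (Real.exp (q1 x))))
    (hH : H = ρ.withDensity (fun x => ENNReal.ofReal (Real.exp (q2 x)))) :
    H = G.withDensity (fun x => ENNReal.ofReal (Real.exp (q2 x - q1 x))) := by
  rw [hG, hH, ← withDensity_mul _ (by fun_prop) (by fun_prop)]
  congr 1
  ext x
  simp only [Pi.mul_apply]
  rw [← ENNReal.ofReal_mul (by positivity), ← Real.exp_add]
  congr 2
  ring

lemma aux_main {n : ℕ} (P G H : Measure (Fin n → ℝ)) [IsProbabilityMeasure P]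
    [IsGaussian G] [IsGaussian H] (C : ℝ)
    (hle : P ≤ ENNReal.ofReal (Real.exp C) • H) (hH : H ≪ volume)
    (hm : ∀ i, meanVec P i = meanVec G i) (hc : ∀ i j, covVec P i j = covVec G i j) :
    KL P G ≤ ENNReal.ofReal C := by
  have hP : ∀ i, MemLp (fun x : Fin n → ℝ => x i) 2 P := fun i =>
    ((aux_memLp H i).smul_measure ENNReal.ofReal_ne_top).mono_measure hle
  have hPac : P ≪ volume :=
    (Measure.absolutelyContinuous_of_le hle).trans
      ((Measure.AbsolutelyContinuous.rfl.smul_left _).trans hH)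
  have hndG : ∀ a : Fin n → ℝ, a ≠ 0 → Var[fun x => ∑ i, a i * x i; G] ≠ 0 := by
    intro a ha
    have h := aux_nondeg P hP hPac a ha
    rw [aux_var_lin P hP] at h
    rw [aux_var_lin G (aux_memLp G)]
    simpa only [hc] using h
  obtain ⟨c1, B1, b1, hd1⟩ := aux_density G hndG
  obtain ⟨c2, B2, b2, hd2⟩ := aux_density H (aux_nondeg H (aux_memLp H) hH)
  obtain ⟨i1, j1, k1⟩ := aux_sq_good P G hP (aux_memLp G) hm hc c1 B1 b1
  obtain ⟨i2, j2, k2⟩ := aux_sq_good P G hP (aux_memLp G) hm hc c2 B2 b2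
  have m1 : Measurable (fun x : Fin n → ℝ => c1 + ∑ k, -(∑ j, B1 k j * (x j - b1 j)) ^ 2 / 2) := by
    fun_prop
  have m2 : Measurable (fun x : Fin n → ℝ => c2 + ∑ k, -(∑ j, B2 k j * (x j - b2 j)) ^ 2 / 2) := by
    fun_prop
  have hr := aux_ratio volume G H _ _ m1 m2 hd1 hd2
  refine aux_KL P G C _ (m2.sub m1) ?_ ?_ (i2.sub i1) (j2.sub j1) ?_
  · exact hr ▸ hle
  · have := measure_univ (μ := H)
    rw [hr, withDensity_apply _ MeasurableSet.univ, Measure.restrict_univ] at this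
    exact this
  · simp only [Pi.sub_apply]
    rw [integral_sub i2 i1, integral_sub j2 j1, k1, k2]

lemma aux_final {n : ℕ} (m : ℕ) (hm : 1 ≤ m) (P V : Measure (Fin n → ℝ)) [IsGaussian P]
    [IsProbabilityMeasure V]
    (hV : V = Measure.pi (fun _ : Fin n =>
      (m : ℝ≥0∞) • (volume.restrict (Set.Ico (0 : ℝ) (1 / m)))))
    (L : Measure (Fin n → ℝ)) [IsProbabilityMeasure L]
    (hL : L = (P.prod V).map (fun p i => quant m (p.1 i) + p.2 i))
    (G : Measure (Fin n → ℝ)) [IsGaussian G]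
    (hmean : ∀ i, meanVec L i = meanVec G i)
    (hcov : ∀ i j, covVec L i j = covVec G i j) :
    KL L G ≤ ENNReal.ofReal (n * ((1 / 2) * Real.log (2 * Real.pi) + 1 / 2)) := by
  have hle := aux_dom m hm P V hV
  rw [← hL] at hle
  have hv : (1 / (m : ℝ≥0)) ^ 2 ≠ 0 := by
    have : (m : ℝ≥0) ≠ 0 := by exact_mod_cast (by omega : m ≠ 0)
    positivity
  have hGN := aux_pi_gauss (n := n) ((1 / (m : ℝ≥0)) ^ 2)
  have hac := aux_pi_ac n _ hv
  generalize Measure.pi (fun _ : Fin n => gaussianReal 0 ((1 / (m : ℝ≥0)) ^ 2)) = N at *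
  have hK : ENNReal.ofReal (√(2 * Real.pi) * Real.exp (1 / 2)) ^ n =
      ENNReal.ofReal (Real.exp (n * ((1 / 2) * Real.log (2 * Real.pi) + 1 / 2))) := by
    rw [← ENNReal.ofReal_pow (by positivity), Real.exp_nat_mul, Real.exp_add]
    congr 3
    rw [Real.sqrt_eq_rpow, Real.rpow_def_of_pos (by positivity), mul_comm]
  rw [hK] at hle
  exact aux_main L G (P ∗ N) _ hle (Measure.conv_absolutelyContinuous hac) hmean hcov

/-- if `X` is an `ℓ`-variate Gaussian vector, `U` is uniform on the cube
`[0, 1/m)^ℓ` and independent of `X`, `W = [X]_m + U`, and `G` is the Gaussian measure with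
the same mean vector and covariance matrix as `W`, then
`KL(law(W) ‖ G) ≤ ℓ·((1/2)·log(2π·(1 + 1/12)) + 75/2 + 24/π)`. -/
theorem stmt13 {Ω : Type*} [MeasurableSpace Ω] (μ : Measure Ω) [IsProbabilityMeasure μ]
    (ℓ : ℕ) (X U : Ω → Fin ℓ → ℝ) (hX : Measurable X) (hU : Measurable U)
    (hXGauss : IsGaussianVec (μ.map X)) (m : ℕ) (hm : 1 ≤ m)
    (hUlaw : μ.map U = Measure.pi (fun _ : Fin ℓ =>
      (m : ℝ≥0∞) • (volume.restrict (Set.Ico (0 : ℝ) (1 / m)))))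
    (hIndep : IndepFun X U μ)
    (W : Ω → Fin ℓ → ℝ) (hW : W = fun ω i => quant m (X ω i) + U ω i)
    (G : Measure (Fin ℓ → ℝ)) (hGGauss : IsGaussianVec G)
    (hmean : ∀ i, meanVec (μ.map W) i = meanVec G i)
    (hcov : ∀ i j, covVec (μ.map W) i j = covVec G i j) :
    KL (μ.map W) G ≤
      (ℓ : ℝ≥0∞) * ENNReal.ofReal
        ((1 / 2) * Real.log (2 * Real.pi * (1 + 1 / 12)) + 75 / 2 + 24 / Real.pi) := by
  have hq := aux_quant_meas m
  have hmeas : Measurable (fun (p : (Fin ℓ → ℝ) × (Fin ℓ → ℝ)) (i : Fin ℓ) =>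
      quant m (p.1 i) + p.2 i) := by
    refine measurable_pi_lambda _ fun i => ?_
    exact (hq.comp ((measurable_pi_apply i).comp measurable_fst)).add
      ((measurable_pi_apply i).comp measurable_snd)
  have hWm : Measurable W := by
    rw [hW]
    refine measurable_pi_lambda _ fun i => ?_
    exact (hq.comp ((measurable_pi_apply i).comp hX)).add ((measurable_pi_apply i).comp hU)
  have hPW : IsProbabilityMeasure (μ.map W) := Measure.isProbabilityMeasure_map hWm.aemeasurable
  have hPX : IsProbabilityMeasure (μ.map X) := hXGauss.1
  have hPU : IsProbabilityMeasure (μ.map U) := Measure.isProbabilityMeasure_map hU.aemeasurable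
  have hlaw : μ.map W = ((μ.map X).prod (μ.map U)).map
      (fun p i => quant m (p.1 i) + p.2 i) := by
    rw [← (indepFun_iff_map_prod_eq_prod_map_map hX.aemeasurable hU.aemeasurable).1 hIndep,
      Measure.map_map hmeas (hX.prodMk hU), hW]
    congr 1
  have hGG := aux_isGaussian G hGGauss
  have hGX := aux_isGaussian _ hXGauss
  refine (aux_final m hm (μ.map X) (μ.map U) hUlaw (μ.map W) hlaw G hmean hcov).trans ?_
  rw [ENNReal.ofReal_mul (by positivity), ENNReal.ofReal_natCast]
  refine mul_le_mul' le_rfl (ENNReal.ofReal_le_ofReal ?_)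
  have hpi := Real.pi_pos
  have h1 : Real.log (2 * Real.pi) ≤ Real.log (2 * Real.pi * (1 + 1 / 12)) :=
    Real.log_le_log (by positivity) (by linarith)
  have h2 : 0 ≤ 24 / Real.pi := by positivity
  linarith
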